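/- For every K-algebra endomorphism σ of I_1 there exist a nonzero scalar ν ∈ K and a unit u of I_1 with u − 1 ∈ F such that σ(H) = u H u^{-1}, σ(∫) = ν · u ∫ u^{-1}, and σ(∂) = ν^{-1} · u ∂ u^{-1}. (Thus every endomorphism of I_1 is the composition of a torus automorphism and an inner automorphism.) -/

import Mathlib

set_option linter.unusedSectionVars false

open Polynomial

noncomputable section

variable (K : Type*) [Field K] [CharZero K]

/-- Formal differentiation `∂` as a `K`-linear endomorphism of `K[x]`. -/
def derOp : Module.End K (Polynomial K) := Polynomial.derivative

/-- Multiplication by `x` as a `K`-linear endomorphism of `K[x]`. -/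
def xOp : Module.End K (Polynomial K) := LinearMap.mulLeft K (Polynomial.X : Polynomial K)

/-- Integration `∫`: the unique `K`-linear map with `∫ xⁿ = xⁿ⁺¹/(n+1)`. -/
def intOp : Module.End K (Polynomial K) :=
  Polynomial.lsum fun n => ((n : K) + 1)⁻¹ • Polynomial.monomial (n + 1)

/-- The algebra `I₁` of polynomial integro-differential operators: the unital
`K`-subalgebra of `End_K K[x]` generated by `X`, `∂` and `∫`. -/
def I1 : Subalgebra K (Module.End K (Polynomial K)) :=
  Algebra.adjoin K {xOp K, derOp K, intOp K}

/-- `H := ∂ ∘ X`. -/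
def Hop : Module.End K (Polynomial K) := derOp K * xOp K

/-- `e_{ij} := ∫^i ∂^j - ∫^{i+1} ∂^{j+1}`. -/
def eOp (i j : ℕ) : Module.End K (Polynomial K) :=
  intOp K ^ i * derOp K ^ j - intOp K ^ (i + 1) * derOp K ^ (j + 1)

/-- `F`, the `K`-linear span of the `e_{ij}`. -/
def Fspan : Submodule K (Module.End K (Polynomial K)) :=
  Submodule.span K (Set.range fun p : ℕ × ℕ => eOp K p.1 p.2)

lemma xOp_mem : xOp K ∈ I1 K := Algebra.subset_adjoin (by simp)
lemma derOp_mem : derOp K ∈ I1 K := Algebra.subset_adjoin (by simp)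
lemma intOp_mem : intOp K ∈ I1 K := Algebra.subset_adjoin (by simp)
lemma Hop_mem : Hop K ∈ I1 K := mul_mem (derOp_mem K) (xOp_mem K)
lemma eOp_mem (i j : ℕ) : eOp K i j ∈ I1 K :=
  sub_mem (mul_mem (pow_mem (intOp_mem K) i) (pow_mem (derOp_mem K) j))
    (mul_mem (pow_mem (intOp_mem K) (i + 1)) (pow_mem (derOp_mem K) (j + 1)))

/-- `H` as an element of `I₁`. -/
def HelI : I1 K := ⟨Hop K, Hop_mem K⟩
/-- `∂` as an element of `I₁`. -/
def DelI : I1 K := ⟨derOp K, derOp_mem K⟩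
/-- `∫` as an element of `I₁`. -/
def IntI : I1 K := ⟨intOp K, intOp_mem K⟩

/-! ### The basis of divided powers -/

def bB : Module.Basis ℕ K (Polynomial K) :=
  (Polynomial.basisMonomials K).isUnitSMul (w := fun n => ((n.factorial : K))⁻¹)
    (fun n => (IsUnit.mk0 _ (inv_ne_zero (Nat.cast_ne_zero.mpr n.factorial_ne_zero))))

lemma bB_apply (n : ℕ) : bB K n = Polynomial.monomial n ((n.factorial : K))⁻¹ := by
  simp [bB, Module.Basis.isUnitSMul_apply, Polynomial.smul_monomial]

lemma D_zero : derOp K (bB K 0) = 0 := by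
  simp [bB_apply, derOp]

lemma fact_aux (n : ℕ) : ((n + 1).factorial : K)⁻¹ * ((n : K) + 1) = ((n.factorial : K))⁻¹ := by
  have h1 : (n.factorial : K) ≠ 0 := Nat.cast_ne_zero.mpr n.factorial_ne_zero
  have h2 : ((n : K) + 1) ≠ 0 := Nat.cast_add_one_ne_zero n
  rw [Nat.factorial_succ]; push_cast; field_simp

lemma D_succ (n : ℕ) : derOp K (bB K (n + 1)) = bB K n := by
  simp only [bB_apply, derOp, Polynomial.derivative_monomial]
  push_cast
  rw [fact_aux]

lemma J_apply (n : ℕ) : intOp K (bB K n) = bB K (n + 1) := by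
  have h2 : ((n : K) + 1) ≠ 0 := Nat.cast_add_one_ne_zero n
  simp only [bB_apply, intOp, Polynomial.lsum_apply]
  rw [Polynomial.sum_monomial_index _ _ (by simp)]
  simp only [LinearMap.smul_apply, Polynomial.smul_monomial]
  rw [← fact_aux K n]; congr 1; rw [smul_eq_mul]; field_simp

lemma X_apply (n : ℕ) : xOp K (bB K n) = ((n : K) + 1) • bB K (n + 1) := by
  simp only [bB_apply, xOp, LinearMap.mulLeft_apply, Polynomial.X_mul_monomial,
    Polynomial.smul_monomial]
  rw [← fact_aux K n, smul_eq_mul, mul_comm]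

lemma H_apply (n : ℕ) : Hop K (bB K n) = ((n : K) + 1) • bB K n := by
  simp [Hop, X_apply, D_succ]

lemma X_eq : xOp K = intOp K * Hop K := by
  refine (bB K).ext fun n => ?_
  simp [X_apply, H_apply, J_apply]

lemma DJ : derOp K * intOp K = 1 := by
  refine (bB K).ext fun n => ?_
  simp [J_apply, D_succ]

/-- matrix entry / coordinate -/
def co (m : ℕ) : Polynomial K →ₗ[K] K := (bB K).coord m

lemma co_b (m n : ℕ) : co K m (bB K n) = if n = m then 1 else 0 := by
  simp [co, Finsupp.single_apply]

lemma co_ext {p q : Polynomial K} (h : ∀ m, co K m p = co K m q) : p = q :=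
  (bB K).repr.injective (Finsupp.ext h)

/-- coordinates of an operator applied, from basis -/
lemma lin_ext {f g : Polynomial K →ₗ[K] K} (h : ∀ n, f (bB K n) = g (bB K n)) (p) : f p = g p := by
  rw [(bB K).ext h]

lemma co_D (m : ℕ) (p) : co K m (derOp K p) = co K (m + 1) p := by
  refine lin_ext K (f := co K m ∘ₗ derOp K) (g := co K (m + 1)) ?_ p
  rintro (_ | n)
  · simp [D_zero, co_b]
  · simp [D_succ, co_b]

lemma co_J_succ (m : ℕ) (p) : co K (m + 1) (intOp K p) = co K m p := by
  refine lin_ext K (f := co K (m + 1) ∘ₗ intOp K) (g := co K m) ?_ p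
  intro n
  simp [J_apply, co_b]

lemma co_J_zero (p) : co K 0 (intOp K p) = 0 := by
  refine lin_ext K (f := co K 0 ∘ₗ intOp K) (g := 0) ?_ p
  intro n
  simp [J_apply, co_b]

lemma co_H (m : ℕ) (p) : co K m (Hop K p) = ((m : K) + 1) * co K m p := by
  refine lin_ext K (f := co K m ∘ₗ Hop K) (g := ((m : K) + 1) • co K m) ?_ p
  intro n
  by_cases h : n = m <;> simp [H_apply, co_b, h]

/-! ### Pairing and adjoints -/

def pr : Polynomial K →ₗ[K] Polynomial K →ₗ[K] K := (bB K).constr K (fun n => co K n)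

lemma pr_b_left (n : ℕ) (q) : pr K (bB K n) q = co K n q := by simp [pr]

lemma pr_b_right (p) (n : ℕ) : pr K p (bB K n) = co K n p := by
  refine lin_ext K (f := (pr K).flip (bB K n)) (g := co K n) ?_ p
  intro m
  simp [pr_b_left, co_b, eq_comm]

def Adj (a a' : Module.End K (Polynomial K)) : Prop := ∀ p q, pr K (a p) q = pr K p (a' q)

variable {K}

lemma adj_of {a a' : Module.End K (Polynomial K)}
    (h : ∀ m n, co K m (a (bB K n)) = co K n (a' (bB K m))) : Adj K a a' := by
  intro p q
  have h1 : pr K ∘ₗ a = LinearMap.flip ((pr K).flip ∘ₗ a') := by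
    refine (bB K).ext fun n => (bB K).ext fun m => ?_
    simp [pr_b_left, pr_b_right, h]
  have := LinearMap.congr_fun (LinearMap.congr_fun h1 p) q
  simpa using this

lemma Adj.co {a a' : Module.End K (Polynomial K)} (h : Adj K a a') (m n) :
    co K m (a (bB K n)) = co K n (a' (bB K m)) := by
  have := h (bB K n) (bB K m)
  rwa [pr_b_left, pr_b_right] at this

lemma Adj.symm {a a' : Module.End K (Polynomial K)} (h : Adj K a a') : Adj K a' a :=
  adj_of fun m n => (h.co n m).symm

lemma Adj.mul {a a' c c' : Module.End K (Polynomial K)} (h : Adj K a a') (h' : Adj K c c') :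
    Adj K (a * c) (c' * a') := fun p q => by
  simp only [Module.End.mul_apply]; rw [h, h']

lemma Adj.add {a a' c c' : Module.End K (Polynomial K)} (h : Adj K a a') (h' : Adj K c c') :
    Adj K (a + c) (a' + c') := fun p q => by
  simp only [LinearMap.add_apply, map_add]; rw [h, h']

lemma Adj.sub {a a' c c' : Module.End K (Polynomial K)} (h : Adj K a a') (h' : Adj K c c') :
    Adj K (a - c) (a' - c') := fun p q => by
  simp only [LinearMap.sub_apply, map_sub]; rw [h, h']

lemma Adj.one : Adj K (1 : Module.End K (Polynomial K)) 1 := fun _ _ => rfl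

lemma Adj.unique {a a' a'' : Module.End K (Polynomial K)} (h : Adj K a a') (h' : Adj K a a'') :
    a' = a'' := by
  refine (bB K).ext fun n => co_ext K fun m => ?_
  rw [← h.co, h'.co]

lemma adj_D : Adj K (derOp K) (intOp K) := by
  refine adj_of fun m n => ?_
  rw [co_D, J_apply, co_b, co_b]
  simp only [eq_comm]

lemma adj_H : Adj K (Hop K) (Hop K) := by
  refine adj_of fun m n => ?_
  rw [co_H, co_H, co_b, co_b]
  by_cases h : n = m
  · simp [h]
  · simp [h, Ne.symm h]

lemma exists_adj {a : Module.End K (Polynomial K)} (ha : a ∈ I1 K) :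
    ∃ a' ∈ I1 K, Adj K a a' := by
  induction ha using Algebra.adjoin_induction with
  | mem x hx =>
    rcases hx with rfl | rfl | rfl
    · rw [X_eq]
      exact ⟨_, mul_mem (Hop_mem K) (derOp_mem K), adj_D.symm.mul adj_H |> id⟩
    · exact ⟨_, intOp_mem K, adj_D⟩
    · exact ⟨_, derOp_mem K, adj_D.symm⟩
  | algebraMap r =>
    refine ⟨_, Subalgebra.algebraMap_mem _ r, fun p q => ?_⟩
    simp [Module.algebraMap_end_apply]
  | add x y _ _ hx hy =>
    obtain ⟨x', h1, h2⟩ := hx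
    obtain ⟨y', h3, h4⟩ := hy
    exact ⟨_, add_mem h1 h3, h2.add h4⟩
  | mul x y _ _ hx hy =>
    obtain ⟨x', h1, h2⟩ := hx
    obtain ⟨y', h3, h4⟩ := hy
    exact ⟨_, mul_mem h3 h1, h2.mul h4⟩

/-! ### Eventually polynomial operators -/

def Good (a : Module.End K (Polynomial K)) : Prop :=
  ∃ (r : ℤ → Polynomial K) (D N : ℕ), (∀ d : ℤ, (D : ℤ) < |d| → r d = 0) ∧
    ∀ n, N ≤ n → ∀ m : ℕ, co K m (a (bB K n)) = (r ((m : ℤ) - n)).eval (n : K)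

lemma Good.add {a c : Module.End K (Polynomial K)} (ha : Good a) (hc : Good c) : Good (a + c) := by
  obtain ⟨r, D, N, h1, h2⟩ := ha
  obtain ⟨r', D', N', h1', h2'⟩ := hc
  refine ⟨fun d => r d + r' d, max D D', max N N', fun d hd => ?_, fun n hn m => ?_⟩
  · simp only [Nat.cast_max, max_lt_iff] at hd
    simp [h1 d hd.1, h1' d hd.2]
  · simp only [max_le_iff] at hn
    simp [← h2 n hn.1, ← h2' n hn.2]

lemma Good.smul {a : Module.End K (Polynomial K)} (ha : Good a) (k : K) : Good (k • a) := by
  obtain ⟨r, D, N, h1, h2⟩ := ha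
  refine ⟨fun d => k • r d, D, N, fun d hd => by simp [h1 d hd], fun n hn m => ?_⟩
  simp [← h2 n hn]

lemma Good.D_mul {a : Module.End K (Polynomial K)} (ha : Good a) : Good (derOp K * a) := by
  obtain ⟨r, D, N, h1, h2⟩ := ha
  refine ⟨fun d => r (d + 1), D + 1, N, fun d hd => h1 _ ?_, fun n hn m => ?_⟩
  · push_cast at hd
    rcases abs_cases d with h | h <;> rcases abs_cases (d + 1) with h' | h' <;> omega
  · rw [Module.End.mul_apply, co_D, h2 n hn]
    congr 2; push_cast; ring

lemma Good.J_mul {a : Module.End K (Polynomial K)} (ha : Good a) : Good (intOp K * a) := by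
  obtain ⟨r, D, N, h1, h2⟩ := ha
  refine ⟨fun d => r (d - 1), D + 1, N + D, fun d hd => h1 _ ?_, fun n hn m => ?_⟩
  · push_cast at hd
    rcases abs_cases d with h | h <;> rcases abs_cases (d - 1) with h' | h' <;> omega
  · rw [Module.End.mul_apply]
    rcases m with _ | m
    · rw [co_J_zero]; beta_reduce; rw [h1]
      · simp
      · push_cast
        rcases abs_cases ((0 : ℤ) - n - 1) with h' | h' <;> omega
    · rw [co_J_succ, h2 n (by omega)]
      congr 2; push_cast; ring

lemma Good.H_mul {a : Module.End K (Polynomial K)} (ha : Good a) : Good (Hop K * a) := by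
  obtain ⟨r, D, N, h1, h2⟩ := ha
  refine ⟨fun d => (Polynomial.X + Polynomial.C ((d : K) + 1)) * r d, D, N,
    fun d hd => by simp [h1 d hd], fun n hn m => ?_⟩
  rw [Module.End.mul_apply, co_H, h2 n hn]
  simp; left; ring

lemma good_one : Good (1 : Module.End K (Polynomial K)) := by
  refine ⟨fun d => if d = 0 then 1 else 0, 0, 0, fun d hd => ?_, fun n _ m => ?_⟩
  · beta_reduce; rw [if_neg]; rintro rfl; simp at hd
  · rw [Module.End.one_apply, co_b]
    by_cases h : n = m
    · simp [h]
    · rw [if_neg h]; beta_reduce; rw [if_neg (by omega)]; simp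

lemma good_of_mem {a : Module.End K (Polynomial K)} (ha : a ∈ I1 K) : Good a := by
  suffices h : ∀ c, Good c → Good (a * c) by simpa using h 1 good_one
  induction ha using Algebra.adjoin_induction with
  | mem x hx =>
    intro c hc
    rcases hx with rfl | rfl | rfl
    · rw [X_eq, mul_assoc]; exact hc.H_mul.J_mul
    · exact hc.D_mul
    · exact hc.J_mul
  | algebraMap r =>
    intro c hc
    rw [← Algebra.smul_def]; exact hc.smul r
  | add x y _ _ hx hy => intro c hc; rw [add_mul]; exact (hx c hc).add (hy c hc)
  | mul x y _ _ hx hy => intro c hc; rw [mul_assoc]; exact hx _ (hy c hc)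

/-! ### Finite rank operators, degrees -/

def FV (f : Module.End K (Polynomial K)) : Prop := ∃ N, ∀ n, N ≤ n → f (bB K n) = 0

lemma expand {v : Polynomial K} {n : ℕ} (h : ∀ m, n ≤ m → co K m v = 0) :
    v = ∑ k ∈ Finset.range n, co K k v • bB K k := by
  refine co_ext K fun m => ?_
  simp only [map_sum, map_smul, co_b, smul_eq_mul, mul_ite, mul_one, mul_zero]
  rw [Finset.sum_ite_eq']
  split_ifs with h1
  · rfl
  · exact h m (by simpa using h1)

lemma bounded (v : Polynomial K) : ∃ M, ∀ m, M ≤ m → co K m v = 0 := by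
  refine ⟨((bB K).repr v).support.sup id + 1, fun m hm => ?_⟩
  by_contra h
  have h1 : m ∈ ((bB K).repr v).support := by
    rw [Finsupp.mem_support_iff]; exact h
  have := Finset.le_sup (f := id) h1
  simp only [id] at this
  omega

lemma bounded' (a : Module.End K (Polynomial K)) (N : ℕ) :
    ∃ M, ∀ k, k < N → ∀ m, M ≤ m → co K m (a (bB K k)) = 0 := by
  choose M hM using fun k => bounded (a (bB K k))
  refine ⟨(Finset.range N).sup M, fun k hk m hm => hM k m ?_⟩
  exact le_trans (Finset.le_sup (f := M) (Finset.mem_range.mpr hk)) hm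

def IsDeg (v : Polynomial K) (n : ℕ) : Prop := co K n v ≠ 0 ∧ ∀ m, n < m → co K m v = 0

lemma IsDeg.unique {v : Polynomial K} {n n' : ℕ} (h : IsDeg v n) (h' : IsDeg v n') : n = n' := by
  rcases lt_trichotomy n n' with h1 | h1 | h1
  · exact absurd (h.2 _ h1) h'.1
  · exact h1
  · exact absurd (h'.2 _ h1) h.1

lemma IsDeg.ne_zero {v : Polynomial K} {n : ℕ} (h : IsDeg v n) : v ≠ 0 := by
  rintro rfl; exact h.1 (map_zero _)

lemma isDeg_b (n : ℕ) : IsDeg (bB K n) n := by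
  refine ⟨by simp [co_b], fun m hm => ?_⟩
  rw [co_b, if_neg (by omega)]

lemma exists_isDeg {v : Polynomial K} (hv : v ≠ 0) : ∃ n, IsDeg v n := by
  classical
  obtain ⟨M, hM⟩ := bounded v
  have hex : ∃ n, n ≤ M ∧ co K n v ≠ 0 := by
    by_contra! h
    apply hv
    refine co_ext K fun m => ?_
    rw [map_zero]
    rcases le_total m M with h1 | h1
    · exact h m h1
    · exact hM m h1
  obtain ⟨n0, hn0, hn0'⟩ := hex
  refine ⟨Nat.findGreatest (fun n => co K n v ≠ 0) M, ?_, fun m hm => ?_⟩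
  · exact Nat.findGreatest_spec (P := fun n => co K n v ≠ 0) hn0 hn0'
  · rcases le_total m M with h1 | h1
    · have := Nat.findGreatest_is_greatest hm h1
      simpa using this
    · exact hM m h1

lemma finite_range {f : Module.End K (Polynomial K)} (hf : FV f) :
    FiniteDimensional K (LinearMap.range f) := by
  obtain ⟨N, hN⟩ := hf
  have h1 : LinearMap.range f ≤ Submodule.span K ((fun n => f (bB K n)) '' (Set.Iio N)) := by
    rintro _ ⟨v, rfl⟩
    obtain ⟨M, hM⟩ := bounded v
    rw [expand hM, map_sum]
    refine Submodule.sum_mem _ fun k _ => ?_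
    rw [map_smul]
    refine Submodule.smul_mem _ _ ?_
    rcases lt_or_ge k N with h | h
    · exact Submodule.subset_span ⟨k, h, rfl⟩
    · rw [hN k h]; exact Submodule.zero_mem _
  have h2 : FiniteDimensional K (Submodule.span K ((fun n => f (bB K n)) '' (Set.Iio N))) :=
    FiniteDimensional.span_of_finite K ((Set.finite_Iio N).image _)
  exact Submodule.finiteDimensional_of_le h1

lemma fredholm {T : Module.End K (Polynomial K)} {k : K} (hk : k ≠ 0) {N : ℕ}
    (hT : ∀ n, N ≤ n → T (bB K n) = k • bB K n) :
    Function.Injective T ↔ Function.Surjective T := by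
  set f : Module.End K (Polynomial K) := T - k • 1 with hf
  have hfin : FiniteDimensional K (LinearMap.range f) := by
    refine finite_range ⟨N, fun n hn => ?_⟩
    simp [hf, hT n hn]
  have hTv : ∀ v, T v = k • v + f v := fun v => by simp [hf]
  have hmem : ∀ v, f v ∈ LinearMap.range f := fun v => ⟨v, rfl⟩
  have hpres : ∀ v ∈ LinearMap.range f, T v ∈ LinearMap.range f := fun v hv => by
    rw [hTv]; exact add_mem (Submodule.smul_mem _ _ hv) (hmem v)
  set g := T.restrict hpres with hg
  have hback : ∀ v, T v ∈ LinearMap.range f → v ∈ LinearMap.range f := fun v hv => by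
    have h1 : k • v ∈ LinearMap.range f := by
      have : k • v = T v - f v := by rw [hTv]; abel
      rw [this]; exact sub_mem hv (hmem v)
    have := Submodule.smul_mem _ k⁻¹ h1
    rwa [smul_smul, inv_mul_cancel₀ hk, one_smul] at this
  constructor
  · intro hinj v
    have h1 : Function.Injective g := fun x y hxy => by
      apply Subtype.ext; apply hinj
      exact congrArg Subtype.val hxy
    have h2 := LinearMap.injective_iff_surjective.mp h1
    obtain ⟨⟨w, hw⟩, hw'⟩ := h2 ⟨f v, hmem v⟩
    have hw2 : T w = f v := congrArg Subtype.val hw'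
    refine ⟨k⁻¹ • (v - w), ?_⟩
    rw [map_smul, map_sub, hw2, hTv]
    rw [add_sub_cancel_right, smul_smul, inv_mul_cancel₀ hk, one_smul]
  · intro hsurj
    have h1 : Function.Surjective g := fun ⟨w, hw⟩ => by
      obtain ⟨v, hv⟩ := hsurj w
      exact ⟨⟨v, hback v (hv ▸ hw)⟩, Subtype.ext hv⟩
    have h2 := LinearMap.injective_iff_surjective.mpr h1
    rw [injective_iff_map_eq_zero]
    intro v hv
    have hv' : v ∈ LinearMap.range f := hback v (by rw [hv]; exact zero_mem _)
    have : (⟨v, hv'⟩ : LinearMap.range f) = 0 := h2 (by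
      rw [map_zero]; exact Subtype.ext hv)
    exact congrArg Subtype.val this

lemma e_apply (i j n : ℕ) : eOp K i j (bB K n) = if n = j then bB K i else 0 := by
  have hD : ∀ j n, (derOp K ^ j) (bB K n) = if j ≤ n then bB K (n - j) else 0 := by
    intro j
    induction j with
    | zero => intro n; simp
    | succ j ih =>
      intro n
      rw [pow_succ, Module.End.mul_apply]
      rcases n with _ | n
      · simp [D_zero]
      · simp [D_succ, ih]
  have hJ : ∀ i n, (intOp K ^ i) (bB K n) = bB K (n + i) := by
    intro i
    induction i with
    | zero => intro n; simp
    | succ i ih =>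
      intro n
      rw [pow_succ, Module.End.mul_apply, J_apply, ih]; congr 1; ring
  simp only [eOp, LinearMap.sub_apply, Module.End.mul_apply, hD]
  rcases lt_trichotomy n j with h | h | h
  · rw [if_neg (by omega), if_neg (by omega), if_neg (by omega)]; simp
  · rw [if_pos (by omega), if_neg (by omega), if_pos h, hJ, h]; simp
  · rw [if_pos (by omega), if_pos (by omega), if_neg (by omega), hJ, hJ]
    rw [sub_eq_zero]; congr 1; omega

lemma mem_Fspan {f : Module.End K (Polynomial K)} (hf : FV f) : f ∈ Fspan K := by
  obtain ⟨N, hN⟩ := hf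
  obtain ⟨M, hM⟩ := bounded' f N
  have : f = ∑ j ∈ Finset.range N, ∑ i ∈ Finset.range M, co K i (f (bB K j)) • eOp K i j := by
    refine (bB K).ext fun n => ?_
    simp only [LinearMap.sum_apply, LinearMap.smul_apply, e_apply]
    rcases lt_or_ge n N with h | h
    · rw [Finset.sum_eq_single n]
      · simp only [if_true]; exact expand (hM n h)
      · intro j _ hj
        simp [Ne.symm hj]
      · intro h'; simp [h] at h'
    · rw [hN n h, eq_comm]
      refine Finset.sum_eq_zero fun j hj => Finset.sum_eq_zero fun i _ => ?_
      rw [if_neg]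
      · simp
      · rintro rfl; simp at hj; omega
  rw [this]
  exact Submodule.sum_mem _ fun j _ => Submodule.sum_mem _ fun i _ =>
    Submodule.smul_mem _ _ (Submodule.subset_span ⟨(i, j), rfl⟩)

lemma Fspan_le {f : Module.End K (Polynomial K)} (hf : f ∈ Fspan K) : f ∈ I1 K := by
  have : Fspan K ≤ Subalgebra.toSubmodule (I1 K) := by
    rw [Fspan, Submodule.span_le]
    rintro _ ⟨⟨i, j⟩, rfl⟩
    exact eOp_mem K i j
  exact this hf

/-! ### Top parts -/

def TopAt (a : Module.End K (Polynomial K)) (d : ℤ) (p : Polynomial K) (N : ℕ) : Prop :=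
  0 ≤ (N : ℤ) + d ∧ ∀ n, N ≤ n → p.eval (n : K) ≠ 0 ∧ ∀ m : ℕ,
    ((m : ℤ) = n + d → co K m (a (bB K n)) = p.eval (n : K)) ∧
    ((n : ℤ) + d < m → co K m (a (bB K n)) = 0)

lemma eventually_ne {p : Polynomial K} (hp : p ≠ 0) : ∃ N : ℕ, ∀ n, N ≤ n → p.eval (n : K) ≠ 0 := by
  have h1 : {n : ℕ | p.eval (n : K) = 0}.Finite := by
    have := (p.rootSet_finite K).preimage (f := fun n : ℕ => (n : K)) (Nat.cast_injective.injOn)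
    refine this.subset fun n hn => ?_
    simp only [Set.mem_preimage, Polynomial.mem_rootSet]
    exact ⟨hp, by simpa using hn⟩
  obtain ⟨M, hM⟩ := h1.bddAbove
  refine ⟨M + 1, fun n hn h => ?_⟩
  have := hM (show n ∈ {n : ℕ | p.eval (n : K) = 0} from h)
  omega

lemma poly_eq {p q : Polynomial K} {N : ℕ} (h : ∀ n, N ≤ n → p.eval (n : K) = q.eval (n : K)) :
    p = q := by
  by_contra hne
  obtain ⟨M, hM⟩ := eventually_ne (sub_ne_zero.mpr hne)
  apply hM (max N M) (le_max_right _ _)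
  rw [Polynomial.eval_sub, h _ (le_max_left _ _), sub_self]

lemma top_or {a : Module.End K (Polynomial K)} (ha : Good a) : FV a ∨ ∃ d p N, TopAt a d p N := by
  obtain ⟨r, D, N, h1, h2⟩ := ha
  by_cases h0 : ∃ d, r d ≠ 0
  · right
    obtain ⟨d, hd, hmax⟩ := Int.exists_greatest_of_bdd (P := fun d => r d ≠ 0)
      ⟨D, fun z hz => by
        by_contra hc
        exact hz (h1 z (lt_of_lt_of_le (not_le.mp hc) (le_abs_self z)))⟩ h0
    obtain ⟨M, hM⟩ := eventually_ne hd
    refine ⟨d, r d, N + M + d.natAbs, by omega, fun n hn => ⟨hM n (by omega), fun m => ⟨?_, ?_⟩⟩⟩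
    · intro hm
      rw [h2 n (by omega), show (m : ℤ) - n = d by omega]
    · intro hm
      rw [h2 n (by omega)]
      have : r ((m : ℤ) - n) = 0 := by
        by_contra hc
        have := hmax _ hc
        omega
      simp [this]
  · left
    push Not at h0
    refine ⟨N, fun n hn => co_ext K fun m => ?_⟩
    simp [h2 n hn, h0]

lemma TopAt.deg {a : Module.End K (Polynomial K)} {d p N} (h : TopAt a d p N) :
    ∃ N' : ℕ, ∀ n : ℕ, N' ≤ n → 0 ≤ (n : ℤ) + d ∧
      ∀ v, IsDeg v n → ∀ m : ℕ, (m : ℤ) = n + d → IsDeg (a v) m := by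
  obtain ⟨M, hM⟩ := bounded' a N
  obtain ⟨h0, h⟩ := h
  refine ⟨N + M + d.natAbs, fun n hn => ⟨by omega, fun v hv m hm => ?_⟩⟩
  have hexp : ∀ m, co K m (a v) = ∑ k ∈ Finset.range (n + 1), co K k v * co K m (a (bB K k)) := by
    intro m
    conv_lhs => rw [expand (v := v) (n := n + 1) (fun m hm => hv.2 m (by omega))]
    simp
  have hz : ∀ m k : ℕ, (n : ℤ) + d ≤ m → k < n → co K m (a (bB K k)) = 0 := by
    intro m k hm hk
    rcases lt_or_ge k N with h1 | h1
    · exact hM k h1 m (by omega)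
    · exact ((h k h1).2 m).2 (by omega)
  refine ⟨?_, fun m' hm' => ?_⟩
  · rw [hexp, Finset.sum_range_succ, Finset.sum_eq_zero, zero_add]
    · rw [((h n (by omega)).2 m).1 hm]
      exact mul_ne_zero hv.1 (h n (by omega)).1
    · intro k hk
      rw [hz m k (by omega) (by simpa using hk), mul_zero]
  · rw [hexp]
    refine Finset.sum_eq_zero fun k hk => ?_
    rcases Nat.lt_or_ge k n with h1 | h1
    · rw [hz m' k (by omega) h1, mul_zero]
    · have : k = n := by simp at hk; omega
      subst this
      rw [((h k (by omega)).2 m').2 (by omega), mul_zero]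

/-! ### Triples -/

structure Trip (A B h : Module.End K (Polynomial K)) : Prop where
  mA : A ∈ I1 K
  mB : B ∈ I1 K
  mh : h ∈ I1 K
  AB : A * B = 1
  hA : h * A = A * h - A
  hB : h * B = B * h + B
  hP : h * (1 - B * A) = 1 - B * A
  Ph : (1 - B * A) * h = 1 - B * A

lemma Trip.adj {A B h A' B' h' : Module.End K (Polynomial K)} (t : Trip A B h)
    (iA : A' ∈ I1 K) (iB : B' ∈ I1 K) (ih : h' ∈ I1 K)
    (aA : Adj K A A') (aB : Adj K B B') (ah : Adj K h h') : Trip B' A' h' where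
  mA := iB
  mB := iA
  mh := ih
  AB := by
    have h1 := aA.mul aB
    rw [t.AB] at h1
    exact h1.unique Adj.one
  hA := by
    have h1 := aB.mul ah
    have h2 := (ah.mul aB).sub aB
    rw [t.hB, add_sub_cancel_right] at h2
    exact h1.unique h2
  hB := by
    have h1 := aA.mul ah
    have h2 := (ah.mul aA).add aA
    rw [t.hA, sub_add_cancel] at h2
    exact h1.unique h2
  hP := by
    have h1 := (Adj.one (K := K)).sub (aB.mul aA)
    have h2 := h1.mul ah
    rw [t.Ph] at h2
    exact h2.unique h1
  Ph := by
    have h1 := (Adj.one (K := K)).sub (aB.mul aA)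
    have h2 := ah.mul h1
    rw [t.hP] at h2
    exact h2.unique h1

lemma topAt_add {A B : Module.End K (Polynomial K)} (h : A * B = 1) {d p N e q M}
    (hA : TopAt A d p N) (hB : TopAt B e q M) : d + e = 0 := by
  obtain ⟨N1, h1⟩ := hA.deg
  obtain ⟨N2, h2⟩ := hB.deg
  set n := N1 + N2 + e.natAbs with hn
  obtain ⟨k, hk⟩ := Int.eq_ofNat_of_zero_le (h2 n (by omega)).1
  have hk' := (h2 n (by omega)).2 _ (isDeg_b n) k hk.symm
  obtain ⟨l, hl⟩ := Int.eq_ofNat_of_zero_le (h1 k (by omega)).1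
  have hl' := (h1 k (by omega)).2 _ hk' l hl.symm
  rw [← Module.End.mul_apply, h, Module.End.one_apply] at hl'
  have := hl'.unique (isDeg_b n)
  omega

lemma not_FV_right {A B : Module.End K (Polynomial K)} (h : A * B = 1) : ¬ FV B := by
  rintro ⟨N, hN⟩
  have h1 : (A * B) (bB K N) = bB K N := by rw [h]; rfl
  rw [Module.End.mul_apply, hN N le_rfl, map_zero] at h1
  exact (bB K).ne_zero N h1.symm

lemma not_FV_of_adj {A A' : Module.End K (Polynomial K)} (a : Adj K A A') {d p N}
    (h : TopAt A' d p N) : ¬ FV A := by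
  rintro ⟨M, hM⟩
  set n := N + M + d.natAbs with hn
  obtain ⟨k, hk⟩ := Int.eq_ofNat_of_zero_le (show 0 ≤ (n : ℤ) + d by omega)
  have h1 := (h.2 n (by omega))
  have h2 := (h1.2 k).1 hk.symm
  rw [← a.co, hM k (by omega), map_zero] at h2
  exact h1.1 h2.symm

def MonoAt (a : Module.End K (Polynomial K)) (d : ℤ) (l : K) : Prop :=
  ∃ N, ∀ m n : ℕ, (N ≤ n ∨ N ≤ m) → co K m (a (bB K n)) = if (m : ℤ) = n + d then l else 0

lemma monoAt_of {a : Module.End K (Polynomial K)} {d : ℤ} {l : K} {N : ℕ}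
    (h : ∀ m n : ℕ, N ≤ n → co K m (a (bB K n)) = if (m : ℤ) = n + d then l else 0) :
    MonoAt a d l := by
  obtain ⟨M, hM⟩ := bounded' a N
  refine ⟨N + M + d.natAbs, fun m n hmn => ?_⟩
  rcases lt_or_ge n N with h1 | h1
  · rw [if_neg (by omega), hM n h1 m (by omega)]
  · exact h m n h1

lemma MonoAt.adj {a a' : Module.End K (Polynomial K)} {d : ℤ} {l : K} (h : MonoAt a d l)
    (ha : Adj K a a') : MonoAt a' (-d) l := by
  obtain ⟨N, hN⟩ := h
  refine ⟨N, fun m n hmn => ?_⟩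
  rw [← ha.co, hN n m hmn.symm]
  congr 1
  rw [eq_iff_iff]; omega

lemma MonoAt.apply {a : Module.End K (Polynomial K)} {d : ℤ} {l : K} (h : MonoAt a d l) :
    ∃ N, ∀ m n : ℕ, N ≤ n → (m : ℤ) = n + d → a (bB K n) = l • bB K m := by
  obtain ⟨N, hN⟩ := h
  refine ⟨N, fun m n hn hm => co_ext K fun k => ?_⟩
  rw [hN k n (Or.inl hn), map_smul, co_b]
  by_cases hk : m = k
  · rw [if_pos (by omega), if_pos hk]; simp
  · rw [if_neg (by omega), if_neg hk]; simp

/-- column shape from tops of `a` and of its adjoint -/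
lemma column {a a' : Module.End K (Polynomial K)} (ha : Adj K a a') {d p N p' N'}
    (h : TopAt a d p N) (h' : TopAt a' (-d) p' N') :
    ∃ M, ∀ m n : ℕ, M ≤ n → co K m (a (bB K n)) = if (m : ℤ) = n + d then p.eval (n : K) else 0 := by
  obtain ⟨M, hM⟩ := bounded' a' N'
  refine ⟨N + M, fun m n hn => ?_⟩
  have h1 := (h.2 n (by omega)).2 m
  split_ifs with hm
  · exact h1.1 hm
  · rcases lt_or_ge m N' with h2 | h2
    · rw [ha.co]; exact hM m h2 n (by omega)
    · rcases lt_or_gt_of_ne hm with h3 | h3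
      · rw [ha.co]; exact ((h'.2 m h2).2 n).2 (by omega)
      · exact h1.2 h3

lemma top_adj_le {a a' : Module.End K (Polynomial K)} (ha : Adj K a a') {d p N d' p' N'}
    (h : TopAt a d p N) (h' : TopAt a' d' p' N') : 0 ≤ d + d' := by
  by_contra hc
  set n := N + N' + d.natAbs with hn
  obtain ⟨k, hk⟩ := Int.eq_ofNat_of_zero_le (show 0 ≤ (n : ℤ) + d by omega)
  have h1 := (h.2 n (by omega))
  have h2 := (h1.2 k).1 hk.symm
  rw [ha.co, ((h'.2 k (by omega)).2 n).2 (by omega)] at h2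
  exact h1.1 h2.symm

lemma Trip.mono {A B h : Module.End K (Polynomial K)} (t : Trip A B h) :
    ∃ (d : ℤ) (l : K), l ≠ 0 ∧ MonoAt A d l ∧ MonoAt B (-d) l⁻¹ := by
  obtain ⟨A', iA, aA⟩ := exists_adj t.mA
  obtain ⟨B', iB, aB⟩ := exists_adj t.mB
  have hBA' : B' * A' = 1 := by
    have h1 := aA.mul aB
    rw [t.AB] at h1
    exact h1.unique Adj.one
  obtain ⟨e, q, M, tB⟩ := (top_or (good_of_mem t.mB)).resolve_left (not_FV_right t.AB)
  obtain ⟨d', p', N', tA'⟩ := (top_or (good_of_mem iA)).resolve_left (not_FV_right hBA')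
  obtain ⟨d, p, N, tA⟩ := (top_or (good_of_mem t.mA)).resolve_left (not_FV_of_adj aA tA')
  obtain ⟨e', q', M', tB'⟩ := (top_or (good_of_mem iB)).resolve_left (not_FV_of_adj aB.symm tB)
  have e1 := topAt_add t.AB tA tB
  have e2 := topAt_add hBA' tB' tA'
  have e3 := top_adj_le aA tA tA'
  have e4 := top_adj_le aB tB tB'
  obtain rfl : d' = -d := by omega
  obtain rfl : e = -d := by omega
  obtain rfl : e' = -(-d) := by omega
  obtain ⟨N1, cA⟩ := column aA tA tA'
  obtain ⟨N2, cB⟩ := column aB tB tB'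
  have aplA : ∀ m n : ℕ, N1 ≤ n → (m : ℤ) = n + d → A (bB K n) = p.eval (n : K) • bB K m := by
    intro m n hn hm
    refine co_ext K fun k => ?_
    rw [cA k n hn, map_smul, co_b]
    by_cases hk : m = k
    · rw [if_pos (by omega), if_pos hk]; simp
    · rw [if_neg (by omega), if_neg hk]; simp
  have aplB : ∀ m n : ℕ, N2 ≤ n → (m : ℤ) = n + -d → B (bB K n) = q.eval (n : K) • bB K m := by
    intro m n hn hm
    refine co_ext K fun k => ?_
    rw [cB k n hn, map_smul, co_b]
    by_cases hk : m = k
    · rw [if_pos (by omega), if_pos hk]; simp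
    · rw [if_neg (by omega), if_neg hk]; simp
  have key : ∀ m n : ℕ, N1 + N2 + d.natAbs ≤ n → (m : ℤ) = n + -d →
      q.eval (n : K) * p.eval (m : K) = 1 := by
    intro m n hn hm
    have h1 : (A * B) (bB K n) = bB K n := by rw [t.AB]; rfl
    rw [Module.End.mul_apply, aplB m n (by omega) hm, map_smul, aplA n m (by omega) (by omega),
      smul_smul] at h1
    have h2 := congrArg (co K n) h1
    rw [map_smul, co_b, if_pos rfl] at h2
    simpa using h2
  have hpoly : q * p.comp (Polynomial.X + Polynomial.C ((-d : ℤ) : K)) = 1 := by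
    refine poly_eq (N := N1 + N2 + d.natAbs) fun n hn => ?_
    obtain ⟨m, hm⟩ := Int.eq_ofNat_of_zero_le (show 0 ≤ (n : ℤ) + -d by omega)
    have h1 := key m n hn hm.symm
    have h2 : (n : K) + ((-d : ℤ) : K) = (m : K) := by
      have := congrArg (Int.cast (R := K)) hm
      push_cast at this ⊢
      exact this
    simp only [Polynomial.eval_mul, Polynomial.eval_comp, Polynomial.eval_add, Polynomial.eval_X,
      Polynomial.eval_C, Polynomial.eval_one]
    rw [h2, h1]
  have hu : IsUnit q := IsUnit.of_mul_eq_one _ hpoly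
  obtain ⟨c, hc, rfl⟩ := Polynomial.isUnit_iff.mp hu
  have hc0 : c ≠ 0 := hc.ne_zero
  refine ⟨d, c⁻¹, inv_ne_zero hc0, monoAt_of (N := N1 + N2 + d.natAbs + d.natAbs) ?_,
    monoAt_of (N := N2) ?_⟩
  · intro m n hn
    rw [cA m n (by omega)]
    split_ifs with hm
    · have := key n m (by omega) (by omega)
      rw [Polynomial.eval_C] at this
      exact eq_inv_of_mul_eq_one_right this
    · rfl
  · intro m n hn
    rw [cB m n hn, inv_inv, Polynomial.eval_C]

lemma iter_D (k n : ℕ) : (derOp K ^ k) (bB K (n + k)) = bB K n := by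
  induction k with
  | zero => simp
  | succ k ih => rw [pow_succ, Module.End.mul_apply, ← add_assoc, D_succ, ih]

lemma iter_J (k n : ℕ) : (intOp K ^ k) (bB K n) = bB K (n + k) := by
  induction k with
  | zero => simp
  | succ k ih => rw [pow_succ', Module.End.mul_apply, ih, J_apply, add_assoc]

lemma D_pow_inj {k : ℕ} (h : Function.Injective (derOp K ^ k)) : k = 0 := by
  rcases k with _ | k
  · rfl
  · exfalso
    apply (bB K).ne_zero 0
    apply h
    rw [pow_succ, Module.End.mul_apply, D_zero, map_zero, map_zero]

lemma J_pow_surj {k : ℕ} (h : Function.Surjective (intOp K ^ k)) : k = 0 := by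
  rcases k with _ | k
  · rfl
  · exfalso
    obtain ⟨v, hv⟩ := h (bB K 0)
    have := congrArg (co K 0) hv
    rw [pow_succ', Module.End.mul_apply, co_J_zero, co_b] at this
    simp at this

/-- a surjective operator cannot shift up -/
lemma index_surj {T : Module.End K (Polynomial K)} {l : K} (hl : l ≠ 0) {k N : ℕ}
    (hT : ∀ n, N ≤ n → T (bB K n) = l • bB K (n + k)) (hs : Function.Surjective T) : k = 0 := by
  have h1 : ∀ n, N ≤ n → (derOp K ^ k * T) (bB K n) = l • bB K n := fun n hn => by
    rw [Module.End.mul_apply, hT n hn, map_smul, iter_D]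
  have hDs : Function.Surjective (derOp K ^ k) := fun v =>
    ⟨(intOp K ^ k) v, by
      refine LinearMap.congr_fun (f := derOp K ^ k * intOp K ^ k) (g := 1) ?_ v
      refine (bB K).ext fun n => ?_
      rw [Module.End.mul_apply, iter_J, iter_D]; rfl⟩
  have h2 : Function.Surjective (derOp K ^ k * T) := by
    rw [Module.End.mul_eq_comp, LinearMap.coe_comp]; exact hDs.comp hs
  have h3 := (fredholm hl h1).mpr h2
  apply D_pow_inj (K := K)
  intro x y hxy
  obtain ⟨x, rfl⟩ := hs x
  obtain ⟨y, rfl⟩ := hs y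
  rw [h3 (a₁ := x) (a₂ := y) hxy]

/-- an injective operator cannot shift down -/
lemma index_inj {T : Module.End K (Polynomial K)} {l : K} (hl : l ≠ 0) {k N : ℕ}
    (hT : ∀ n, N ≤ n → T (bB K (n + k)) = l • bB K n) (hs : Function.Injective T) : k = 0 := by
  have h1 : ∀ n, N ≤ n → (T * intOp K ^ k) (bB K n) = l • bB K n := fun n hn => by
    rw [Module.End.mul_apply, iter_J, hT n hn]
  have hJi : Function.Injective (intOp K ^ k) := by
    have : derOp K ^ k * intOp K ^ k = 1 := by
      refine (bB K).ext fun n => ?_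
      rw [Module.End.mul_apply, iter_J, iter_D]; rfl
    intro x y hxy
    have h2 := congrArg (derOp K ^ k) hxy
    rwa [← Module.End.mul_apply, ← Module.End.mul_apply, this] at h2
  have h2 : Function.Injective (T * intOp K ^ k) := by
    rw [Module.End.mul_eq_comp, LinearMap.coe_comp]; exact hs.comp hJi
  have h3 := (fredholm hl h1).mp h2
  apply J_pow_surj (K := K)
  intro v
  obtain ⟨w, hw⟩ := h3 (T v)
  exact ⟨w, hs hw⟩

lemma MonoAt.co_apply {a a' : Module.End K (Polynomial K)} {d : ℤ} {l : K} (h : MonoAt a d l)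
    (ha : Adj K a a') : ∃ N, ∀ m n : ℕ, N ≤ m → (m : ℤ) = n + d → ∀ v, co K m (a v) = l * co K n v := by
  obtain ⟨N, hN⟩ := (h.adj ha).apply
  refine ⟨N, fun m n hm hmn v => ?_⟩
  rw [← pr_b_right, ha, hN n m hm (by omega), map_smul, pr_b_right, smul_eq_mul]

lemma Trip.surj {A B h : Module.End K (Polynomial K)} (t : Trip A B h) : Function.Surjective A :=
  fun v => ⟨B v, by rw [← Module.End.mul_apply, t.AB]; rfl⟩

lemma Trip.down {A B h : Module.End K (Polynomial K)} (t : Trip A B h) :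
    ∃ (i : ℕ) (l : K), 1 ≤ i ∧ l ≠ 0 ∧ MonoAt A (-(i : ℤ)) l ∧ MonoAt B i l⁻¹ ∧
      ∃ N, ∀ n, N ≤ n → co K (n + i) (h (bB K (n + i))) = co K n (h (bB K n)) + 1 := by
  obtain ⟨d, l, hl, mA, mB⟩ := t.mono
  obtain ⟨A', iA, aA⟩ := exists_adj t.mA
  obtain ⟨N1, h1⟩ := mA.co_apply aA
  obtain ⟨N2, h2⟩ := mA.apply
  have key : ∀ m n : ℕ, N1 ≤ m → N2 ≤ n → (m : ℤ) = n + d →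
      co K m (h (bB K m)) = co K n (h (bB K n)) - 1 := by
    intro m n hm hn hmn
    have e1 := LinearMap.congr_fun t.hA (bB K n)
    rw [Module.End.mul_apply, LinearMap.sub_apply, Module.End.mul_apply, h2 m n hn hmn] at e1
    have e2 := congrArg (co K m) e1
    rw [map_smul, map_smul, map_sub, h1 m n hm hmn, map_smul, co_b, if_pos rfl, smul_eq_mul,
      smul_eq_mul, mul_one] at e2
    apply mul_left_cancel₀ hl
    rw [e2]; ring
  have hd0 : d ≠ 0 := by
    rintro rfl
    have := key (N1 + N2) (N1 + N2) (by omega) (by omega) (by simp)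
    have h3 : (1 : K) = 0 := by linear_combination this
    exact one_ne_zero h3
  have hd : d < 0 := by
    by_contra hc
    obtain ⟨k, rfl⟩ := Int.eq_ofNat_of_zero_le (not_lt.mp hc)
    have := index_surj hl (k := k) (N := N2) (fun n hn => h2 (n + k) n hn (by push_cast; ring)) t.surj
    omega
  obtain ⟨i, hi⟩ := Int.eq_ofNat_of_zero_le (show 0 ≤ -d by omega)
  obtain rfl : d = -(i : ℤ) := by omega
  refine ⟨i, l, by omega, hl, mA, by simpa using mB, N1 + N2, fun n hn => ?_⟩
  have := key n (n + i) (by omega) (by omega) (by push_cast; ring)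
  linear_combination -this

/-! ### Local nilpotence -/

def MM (n : ℕ) : Submodule K (Polynomial K) where
  carrier := {v | ∀ m, n ≤ m → co K m v = 0}
  add_mem' := fun ha hb m hm => by rw [map_add, ha m hm, hb m hm, add_zero]
  zero_mem' := fun m _ => map_zero _
  smul_mem' := fun c v hv m hm => by rw [map_smul, hv m hm, smul_zero]

lemma MM_mono {m n : ℕ} (h : m ≤ n) : (MM m : Submodule K (Polynomial K)) ≤ MM n :=
  fun _ hv k hk => hv k (h.trans hk)

instance (n : ℕ) : FiniteDimensional K (MM n : Submodule K (Polynomial K)) := by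
  have h1 : (MM n : Submodule K (Polynomial K)) ≤ Submodule.span K ((bB K) '' (Set.Iio n)) := by
    intro v hv
    rw [expand hv]
    exact Submodule.sum_mem _ fun k hk => Submodule.smul_mem _ _
      (Submodule.subset_span ⟨k, by simpa using hk, rfl⟩)
  have h2 : FiniteDimensional K (Submodule.span K ((bB K) '' (Set.Iio n))) :=
    FiniteDimensional.span_of_finite K ((Set.finite_Iio n).image _)
  exact Submodule.finiteDimensional_of_le h1

def NilS (A : Module.End K (Polynomial K)) : Submodule K (Polynomial K) where
  carrier := {v | ∃ k : ℕ, (A ^ k) v = 0}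
  add_mem' := by
    rintro v w ⟨k, hk⟩ ⟨j, hj⟩
    refine ⟨k + j, ?_⟩
    rw [map_add]
    have h1 : (A ^ (k + j)) v = 0 := by
      rw [add_comm, pow_add, Module.End.mul_apply, hk, map_zero]
    have h2 : (A ^ (k + j)) w = 0 := by
      rw [pow_add, Module.End.mul_apply, hj, map_zero]
    rw [h1, h2, add_zero]
  zero_mem' := ⟨0, map_zero _⟩
  smul_mem' := by
    rintro c v ⟨k, hk⟩
    exact ⟨k, by rw [map_smul, hk, smul_zero]⟩

lemma Trip.A_pow_h {A B h : Module.End K (Polynomial K)} (t : Trip A B h) (k : ℕ) :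
    A ^ k * h = h * A ^ k + (k : K) • A ^ k := by
  induction k with
  | zero => simp
  | succ k ih =>
    have h1 : A * h = h * A + A := by rw [t.hA]; abel
    rw [pow_succ', mul_assoc, ih, mul_add, ← mul_assoc, h1, add_mul, mul_assoc, mul_smul_comm]
    push_cast; rw [add_smul, one_smul]; abel

lemma Trip.nilp {A B h : Module.End K (Polynomial K)} (t : Trip A B h) (v : Polynomial K) :
    ∃ k : ℕ, (A ^ k) v = 0 := by
  obtain ⟨i, l, hi, hl, mA, -, -⟩ := t.down
  obtain ⟨N, hN⟩ := mA.apply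
  obtain ⟨M1, hM1⟩ := bounded' A (N + i)
  have hstep : ∀ n, N + i + M1 ≤ n → ∀ v ∈ (MM (n + 1) : Submodule K (Polynomial K)), A v ∈ MM (K := K) n := by
    intro n hn v hv m hm
    rw [expand hv, map_sum, map_sum]
    refine Finset.sum_eq_zero fun k hk => ?_
    rw [Finset.mem_range] at hk
    rw [map_smul, map_smul]
    rcases lt_or_ge k (N + i) with h1 | h1
    · rw [hM1 k h1 m (by omega), smul_zero]
    · rw [hN (k - i) k (by omega) (by omega), map_smul, co_b, if_neg (by omega), smul_zero, smul_zero]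
  set n0 := N + i + M1 with hn0
  have hpres : ∀ v ∈ (MM n0 : Submodule K (Polynomial K)), A v ∈ MM (K := K) n0 := fun v hv =>
    hstep n0 le_rfl v (MM_mono (Nat.le_succ _) hv)
  have hfall : ∀ j, ∀ v ∈ (MM (n0 + j) : Submodule K (Polynomial K)), (A ^ j) v ∈ MM (K := K) n0 := by
    intro j
    induction j with
    | zero => intro v hv; simpa using hv
    | succ j ih =>
      intro v hv
      rw [pow_succ, Module.End.mul_apply]
      exact ih _ (hstep (n0 + j) (by omega) v hv)
  set g := A.restrict hpres with hg
  have hgp : ∀ (k : ℕ) (x : (MM n0 : Submodule K (Polynomial K))), ((g ^ k) x : Polynomial K) = (A ^ k) x := by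
    intro k
    induction k with
    | zero => intro x; simp
    | succ k ih =>
      intro x
      rw [pow_succ, Module.End.mul_apply, ih, pow_succ, Module.End.mul_apply]; rfl
  have hsum : ∀ v : Polynomial K, ∃ m : (MM n0 : Submodule K (Polynomial K)),
      v - (m : Polynomial K) ∈ NilS A := by
    intro v
    obtain ⟨k, hk⟩ := bounded v
    have hw := hfall k v (fun m hm => hk m (by omega))
    have hc := g.isCompl_iSup_ker_pow_iInf_range_pow
    obtain ⟨w1, hw1, w2, hw2, hsumw⟩ := Submodule.mem_sup.mp
      ((hc.sup_eq_top ▸ Submodule.mem_top : (⟨_, hw⟩ : (MM n0 : Submodule K (Polynomial K))) ∈ _))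
    rw [Submodule.mem_iInf] at hw2
    obtain ⟨m, hm⟩ := hw2 k
    have hmono : Monotone fun n => LinearMap.ker (g ^ n) := g.iterateKer.monotone
    rw [Submodule.mem_iSup_of_directed _ hmono.directed_le] at hw1
    obtain ⟨j, hj⟩ := hw1
    refine ⟨m, j + k, ?_⟩
    have e1 : (A ^ k) v = w1 + w2 := (congrArg Subtype.val hsumw).symm
    have e2 : (A ^ k) m = w2 := by rw [← hgp, hm]
    rw [pow_add, Module.End.mul_apply, map_sub, e1, e2, add_sub_cancel_right, ← hgp]
    exact congrArg Subtype.val hj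
  set W := NilS A with hW
  have iA : W ≤ W.comap A := by
    rintro v ⟨k, hk⟩
    refine ⟨k, ?_⟩
    rw [← Module.End.mul_apply, ← pow_succ, pow_succ', Module.End.mul_apply, hk, map_zero]
  have iB : W ≤ W.comap B := by
    rintro v ⟨k, hk⟩
    refine ⟨k + 1, ?_⟩
    rw [← Module.End.mul_apply, pow_succ, mul_assoc, t.AB, mul_one, hk]
  have ih : W ≤ W.comap h := by
    rintro v ⟨k, hk⟩
    refine ⟨k, ?_⟩
    rw [← Module.End.mul_apply, t.A_pow_h, LinearMap.add_apply, Module.End.mul_apply,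
      LinearMap.smul_apply, hk, map_zero, smul_zero, add_zero]
  have hfin : FiniteDimensional K (Polynomial K ⧸ W) := by
    refine Module.Finite.of_surjective (W.mkQ ∘ₗ (MM n0 : Submodule K (Polynomial K)).subtype) ?_
    intro q
    obtain ⟨v, rfl⟩ := W.mkQ_surjective q
    obtain ⟨m, hm⟩ := hsum v
    refine ⟨m, ?_⟩
    symm
    rw [LinearMap.comp_apply, Submodule.mkQ_apply, Submodule.mkQ_apply]
    exact (Submodule.Quotient.eq W).mpr hm
  set qA : Module.End K (Polynomial K ⧸ W) := W.mapQ W A iA with hqA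
  set qB : Module.End K (Polynomial K ⧸ W) := W.mapQ W B iB with hqB
  set qh : Module.End K (Polynomial K ⧸ W) := W.mapQ W h ih with hqh
  have r1 : qA * qB = 1 := by
    refine Submodule.linearMap_qext _ (LinearMap.ext fun x => ?_)
    have := LinearMap.congr_fun t.AB x
    simp only [Module.End.mul_apply, Module.End.one_apply] at this
    simp [hqA, hqB, Submodule.mapQ_apply, this]
  have r2 : qh * qA = qA * qh - qA := by
    refine Submodule.linearMap_qext _ (LinearMap.ext fun x => ?_)
    have := LinearMap.congr_fun t.hA x
    simp only [Module.End.mul_apply, LinearMap.sub_apply] at this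
    simp [hqA, hqh, Submodule.mapQ_apply, this]
  have r3 : qB * qA = 1 := mul_eq_one_comm.mp r1
  have r4 : qh = qA * (qh * qB) - 1 := by
    have : qh * qA * qB = (qA * qh - qA) * qB := by rw [r2]
    rw [mul_assoc, r1, mul_one, sub_mul, r1, mul_assoc] at this
    exact this
  have r5 := congrArg (LinearMap.trace K _) r4
  rw [map_sub, LinearMap.trace_mul_comm, mul_assoc, r3, mul_one, LinearMap.trace_one] at r5
  have r6 : (Module.finrank K (Polynomial K ⧸ W) : K) = 0 := by linear_combination r5
  have r7 : Module.finrank K (Polynomial K ⧸ W) = 0 := by exact_mod_cast r6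
  have r8 := Module.finrank_zero_iff.mp r7
  have : v ∈ W := by
    rw [← Submodule.Quotient.mk_eq_zero]
    exact Subsingleton.elim _ _
  exact this

/-! ### Spectrum of h -/

def fp (K : Type*) [Field K] (n : ℕ) : Polynomial K :=
  ∏ j ∈ Finset.range n, (Polynomial.X - Polynomial.C ((j : K) + 1))

lemma fp_shift (n : ℕ) : fp K (n + 1) =
    (Polynomial.X - 1) * (fp K n).comp (Polynomial.X - 1) := by
  rw [fp, Finset.prod_range_succ', fp, Polynomial.prod_comp, mul_comm]
  congr 1
  · simp
  · refine Finset.prod_congr rfl fun j _ => ?_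
    simp; ring

lemma Trip.semi {A B h : Module.End K (Polynomial K)} (t : Trip A B h) (f : Polynomial K) :
    Polynomial.aeval h f * A = A * Polynomial.aeval h (f.comp (Polynomial.X - 1)) := by
  have h1 : h * A = A * (h - 1) := by rw [t.hA, mul_sub, mul_one]
  rw [Polynomial.aeval_comp, map_sub, Polynomial.aeval_X, map_one]
  induction f using Polynomial.induction_on' with
  | add p q hp hq => rw [map_add, map_add, add_mul, mul_add, hp, hq]
  | monomial n c =>
    have h2 : ∀ n : ℕ, h ^ n * A = A * (h - 1) ^ n := by
      intro n
      have : SemiconjBy A (h - 1) h := h1.symm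
      exact (this.pow_right n).eq.symm
    rw [Polynomial.aeval_monomial, Polynomial.aeval_monomial, mul_assoc, h2, ← mul_assoc,
      Algebra.commutes, mul_assoc]

lemma Trip.kill {A B h : Module.End K (Polynomial K)} (t : Trip A B h) (n : ℕ) :
    ∀ v, (A ^ n) v = 0 → Polynomial.aeval h (fp K n) v = 0 := by
  induction n with
  | zero => intro v hv; simpa [fp] using hv
  | succ n ih =>
    intro v hv
    rw [pow_succ, Module.End.mul_apply] at hv
    have h1 := ih _ hv
    rw [← Module.End.mul_apply, t.semi, Module.End.mul_apply] at h1
    rw [fp_shift, map_mul, Module.End.mul_apply]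
    set w := Polynomial.aeval h ((fp K n).comp (Polynomial.X - 1)) v
    have h2 : (1 - B * A) w = w := by
      rw [LinearMap.sub_apply, Module.End.mul_apply, h1, map_zero, sub_zero]; rfl
    have h3 : h w = w := by
      have := LinearMap.congr_fun t.hP w
      rwa [Module.End.mul_apply, h2] at this
    simp [h3]

lemma Trip.eigen {A B h : Module.End K (Polynomial K)} (t : Trip A B h) {v : Polynomial K} {r : K}
    (hv : v ≠ 0) (hr : h v = r • v) : ∃ j : ℕ, r = (j : K) + 1 := by
  obtain ⟨k, hk⟩ := t.nilp v
  have h1 := t.kill k v hk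
  have h2 : Module.End.HasEigenvector h r v := by
    rw [Module.End.hasEigenvector_iff]
    exact ⟨Module.End.mem_eigenspace_iff.mpr hr, hv⟩
  rw [Module.End.aeval_apply_of_hasEigenvector h2, smul_eq_zero] at h1
  have h3 := h1.resolve_right hv
  rw [fp, Polynomial.eval_prod, Finset.prod_eq_zero_iff] at h3
  obtain ⟨j, -, hj⟩ := h3
  refine ⟨j, ?_⟩
  simp at hj
  linear_combination hj

lemma Trip.upper {A B h : Module.End K (Polynomial K)} (t : Trip A B h) :
    ∃ N, ∀ n, N ≤ n → ∀ m, n < m → co K m (h (bB K n)) = 0 := by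
  rcases top_or (good_of_mem t.mh) with ⟨N, hN⟩ | ⟨d, p, N, hT⟩
  · exact ⟨N, fun n hn m _ => by rw [hN n hn, map_zero]⟩
  · rcases le_or_gt d 0 with hd | hd
    · exact ⟨N, fun n hn m hm => ((hT.2 n hn).2 m).2 (by omega)⟩
    · exfalso
      obtain ⟨N', hN'⟩ := hT.deg
      obtain ⟨e, rfl⟩ := Int.eq_ofNat_of_zero_le hd.le
      have key : ∀ k : ℕ, ∃ n, N' ≤ n ∧ IsDeg (Polynomial.aeval h (fp K k) (bB K N')) n := by
        intro k
        induction k with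
        | zero => exact ⟨N', le_rfl, by simpa [fp] using isDeg_b N'⟩
        | succ k ih =>
          obtain ⟨n, hn, hn'⟩ := ih
          refine ⟨n + e, by omega, ?_⟩
          rw [fp, Finset.prod_range_succ, mul_comm, map_mul, Module.End.mul_apply, ← fp]
          set w := Polynomial.aeval h (fp K k) (bB K N')
          have h1 := (hN' n hn).2 w hn' (n + e) (by push_cast; ring)
          have h2 : ∀ m, n + e ≤ m → co K m
              (Polynomial.aeval h (Polynomial.X - Polynomial.C ((k : K) + 1)) w) = co K m (h w) := by
            intro m hm
            have h3 : co K m w = 0 := hn'.2 m (by omega)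
            rw [map_sub, Polynomial.aeval_X, Polynomial.aeval_C, LinearMap.sub_apply, map_sub,
              Module.algebraMap_end_apply, map_smul, h3, smul_zero, sub_zero]
          exact ⟨by rw [h2 _ le_rfl]; exact h1.1, fun m hm => by rw [h2 m hm.le]; exact h1.2 m hm⟩
      obtain ⟨k, hk⟩ := t.nilp (bB K N')
      obtain ⟨n, -, hn⟩ := key k
      exact hn.ne_zero (t.kill k _ hk)

lemma Trip.diag {A B h : Module.End K (Polynomial K)} (t : Trip A B h) :
    ∃ N, ∀ n, N ≤ n → h (bB K n) = co K n (h (bB K n)) • bB K n := by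
  obtain ⟨A', iA, aA⟩ := exists_adj t.mA
  obtain ⟨B', iB, aB⟩ := exists_adj t.mB
  obtain ⟨h', ih, ah⟩ := exists_adj t.mh
  have t' := t.adj iA iB ih aA aB ah
  obtain ⟨N, hN⟩ := t.upper
  obtain ⟨N', hN'⟩ := t'.upper
  obtain ⟨M, hM⟩ := bounded' h' N'
  refine ⟨N + M, fun n hn => co_ext K fun m => ?_⟩
  rw [map_smul, co_b]
  rcases lt_trichotomy n m with h1 | rfl | h1
  · rw [hN n (by omega) m h1, if_neg (by omega), smul_zero]
  · simp
  · rw [if_neg (by omega), smul_zero, ah.co]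
    rcases lt_or_ge m N' with h2 | h2
    · exact hM m h2 n (by omega)
    · exact hN' m h2 n h1

lemma Trip.unit_shift {A B h : Module.End K (Polynomial K)} (t : Trip A B h) :
    ∃ (l : K) (N : ℕ), l ≠ 0 ∧ (∀ n, N ≤ n → A (bB K (n + 1)) = l • bB K n) ∧
      (∀ n, N ≤ n → B (bB K n) = l⁻¹ • bB K (n + 1)) ∧
      (∀ n, N ≤ n → ∃ j : ℕ, h (bB K n) = ((j : K) + 1) • bB K n) := by
  obtain ⟨i, l, hi, hl, mA, mB, N1, h1⟩ := t.down
  obtain ⟨N2, h2⟩ := t.diag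
  obtain ⟨r, D, N3, -, h3⟩ := good_of_mem t.mh
  have hs : ∀ n, N3 ≤ n → co K n (h (bB K n)) = (r 0).eval (n : K) := fun n hn => by
    rw [h3 n hn, sub_self]
  have hj : ∀ n, N2 ≤ n → ∃ j : ℕ, co K n (h (bB K n)) = (j : K) + 1 := fun n hn =>
    t.eigen ((bB K).ne_zero n) (h2 n hn)
  set N := N1 + N2 + N3 with hN
  have hi0 : (i : K) ≠ 0 := Nat.cast_ne_zero.mpr (by omega)
  have hk : ∀ k : ℕ, (r 0).eval ((N + k * i : ℕ) : K) = (r 0).eval (N : K) + k := by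
    intro k
    induction k with
    | zero => simp
    | succ k ih =>
      have := h1 (N + k * i) (by omega)
      rw [hs _ (by omega), hs _ (by omega), ih] at this
      rw [show N + (k + 1) * i = N + k * i + i by ring, this]
      push_cast; ring
  have hp : (r 0).comp (Polynomial.C (i : K) * Polynomial.X + Polynomial.C (N : K)) =
      Polynomial.X + Polynomial.C ((r 0).eval (N : K)) := by
    refine poly_eq (N := 0) fun k _ => ?_
    have := hk k
    push_cast at this
    simp only [Polynomial.eval_comp, Polynomial.eval_add, Polynomial.eval_mul, Polynomial.eval_C,
      Polynomial.eval_X]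
    rw [show (i : K) * k + N = N + k * i by ring, this]; ring
  have hq := congrArg (Polynomial.eval ((i : K)⁻¹)) hp
  simp only [Polynomial.eval_comp, Polynomial.eval_add, Polynomial.eval_mul, Polynomial.eval_C,
      Polynomial.eval_X, mul_inv_cancel₀ hi0] at hq
  obtain ⟨j, ej⟩ := hj N (by omega)
  obtain ⟨j', ej'⟩ := hj (N + 1) (by omega)
  rw [hs _ (by omega)] at ej ej'
  push_cast at ej'
  rw [add_comm, ej', ej] at hq
  have hq2 : (i : K) * ((j' : K) - j) = 1 := by
    have : (j' : K) - j = (i : K)⁻¹ := by linear_combination hq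
    rw [this, mul_inv_cancel₀ hi0]
  have hq3 : (i : ℤ) * ((j' : ℤ) - j) = 1 := by exact_mod_cast hq2
  have hi1 : i = 1 := by
    have := Int.eq_one_or_neg_one_of_mul_eq_one hq3
    omega
  subst hi1
  obtain ⟨N4, h4⟩ := mA.apply
  obtain ⟨N5, h5⟩ := mB.apply
  refine ⟨l, N2 + N4 + N5, hl, fun n hn => h4 n (n + 1) (by omega) (by push_cast; ring),
    fun n hn => h5 (n + 1) n (by omega) (by push_cast; ring), fun n hn => ?_⟩
  obtain ⟨j, hj⟩ := hj n (by omega)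
  exact ⟨j, by rw [h2 n (by omega)]; rw [hj]⟩

lemma D_ker {p : Polynomial K} (h : derOp K p = 0) : p = co K 0 p • bB K 0 := by
  have : ∀ m, 1 ≤ m → co K m p = 0 := by
    rintro (_ | m) hm
    · omega
    · rw [← co_D, h, map_zero]
  have := expand this
  simpa using this

lemma Trip.final {A B h : Module.End K (Polynomial K)} (t : Trip A B h) :
    ∃ (l : K) (u u' : Module.End K (Polynomial K)), l ≠ 0 ∧ FV (u - 1) ∧ FV (u' - 1) ∧
      u * u' = 1 ∧ u' * u = 1 ∧ h = u * Hop K * u' ∧ B = l⁻¹ • (u * intOp K * u') ∧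
      A = l • (u * derOp K * u') := by
  obtain ⟨l, N, hl, aA, aB, ah⟩ := t.unit_shift
  -- a kernel vector
  obtain ⟨v0, hv0, hAv0⟩ : ∃ v0, v0 ≠ 0 ∧ A v0 = 0 := by
    classical
    have hex := t.nilp (bB K 0)
    have h1 := Nat.find_spec hex
    have h2 : Nat.find hex ≠ 0 := by
      intro h0
      rw [h0] at h1
      exact (bB K).ne_zero 0 (by simpa using h1)
    obtain ⟨k, hk⟩ := Nat.exists_eq_succ_of_ne_zero h2
    refine ⟨(A ^ k) (bB K 0), Nat.find_min hex (by omega), ?_⟩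
    rw [← Module.End.mul_apply, ← pow_succ']
    rw [hk] at h1; exact h1
  have hABv : ∀ v, A (B v) = v := fun v => by
    rw [← Module.End.mul_apply, t.AB]; rfl
  -- the kernel is a line
  have hker : ∀ v, A v = 0 → ∃ c : K, v = c • v0 := by
    set T : Module.End K (Polynomial K) := B * derOp K + (co K 0).smulRight v0 with hT
    have hTv : ∀ p, T p = B (derOp K p) + co K 0 p • v0 := fun p => by simp [hT]
    have hAT : ∀ p, A (T p) = derOp K p := fun p => by
      rw [hTv, map_add, hABv, map_smul, hAv0, smul_zero, add_zero]
    have hTb : ∀ n, N + 1 ≤ n → T (bB K n) = l⁻¹ • bB K n := by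
      rintro (_ | n) hn
      · omega
      · rw [hTv, D_succ, aB n (by omega), co_b, if_neg (by omega), zero_smul, add_zero]
    have hinj : Function.Injective T := by
      rw [injective_iff_map_eq_zero]
      intro p hp
      have h1 : derOp K p = 0 := by rw [← hAT, hp, map_zero]
      rw [hTv, h1, map_zero, zero_add, smul_eq_zero] at hp
      rw [D_ker h1, hp.resolve_right hv0, zero_smul]
    have hsurj := (fredholm (inv_ne_zero hl) hTb).mp hinj
    intro v hv
    obtain ⟨p, rfl⟩ := hsurj v
    rw [hAT] at hv
    exact ⟨co K 0 p, by rw [hTv, hv, map_zero, zero_add]⟩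
  -- the intertwiner
  set u : Module.End K (Polynomial K) := (bB K).constr K (fun n => l ^ n • (B ^ n) v0) with hu
  have hub : ∀ n, u (bB K n) = l ^ n • (B ^ n) v0 := fun n => by
    rw [hu, Module.Basis.constr_basis]
  have uJ : u * intOp K = l • (B * u) := by
    refine (bB K).ext fun n => ?_
    simp only [Module.End.mul_apply, LinearMap.smul_apply, J_apply, hub, map_smul, smul_smul]
    rw [← Module.End.mul_apply, ← pow_succ', ← pow_succ']
  have uD : A * u = l • (u * derOp K) := by
    refine (bB K).ext fun n => ?_
    rcases n with _ | n
    · simp [D_zero, hub, hAv0]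
    · simp only [Module.End.mul_apply, LinearMap.smul_apply, D_succ, hub, map_smul, smul_smul]
      rw [pow_succ' B, Module.End.mul_apply, hABv, pow_succ']
  have hhv0 : h v0 = v0 := by
    have h1 : (1 - B * A) v0 = v0 := by
      rw [LinearMap.sub_apply, Module.End.mul_apply, hAv0, map_zero, sub_zero]; rfl
    have := LinearMap.congr_fun t.hP v0
    rwa [Module.End.mul_apply, h1] at this
  have hBn : ∀ n : ℕ, h ((B ^ n) v0) = ((n : K) + 1) • (B ^ n) v0 := by
    intro n
    induction n with
    | zero => simp [hhv0]
    | succ n ih =>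
      rw [pow_succ', Module.End.mul_apply, ← Module.End.mul_apply h B, t.hB, LinearMap.add_apply,
        Module.End.mul_apply, ih, map_smul]
      push_cast
      module
  have uH : h * u = u * Hop K := by
    refine (bB K).ext fun n => ?_
    simp only [Module.End.mul_apply, H_apply, hub, map_smul, hBn]
    rw [smul_comm]
  have uDv : ∀ v, A (u v) = l • u (derOp K v) := fun v => LinearMap.congr_fun uD v
  have uinj : Function.Injective u := by
    rw [injective_iff_map_eq_zero]
    have key : ∀ n v, (derOp K ^ n) v = 0 → u v = 0 → v = 0 := by
      intro n
      induction n with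
      | zero => intro v hv _; simpa using hv
      | succ n ih =>
        intro v hv huv
        rw [pow_succ, Module.End.mul_apply] at hv
        have h1 : u (derOp K v) = 0 := by
          have := uDv v
          rw [huv, map_zero, eq_comm, smul_eq_zero] at this
          exact this.resolve_left hl
        have h2 := D_ker (ih _ hv h1)
        rw [h2, map_smul, hub] at huv
        simp only [pow_zero, one_smul, Module.End.one_apply, smul_eq_zero] at huv
        rw [h2, huv.resolve_right hv0, zero_smul]
    intro v huv
    obtain ⟨M, hM⟩ := bounded v
    refine key M v ?_ huv
    refine co_ext K fun m => ?_
    have : ∀ (k m : ℕ) (v : Polynomial K), co K m ((derOp K ^ k) v) = co K (m + k) v := by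
      intro k
      induction k with
      | zero => intro m v; simp
      | succ k ih => intro m v; rw [pow_succ, Module.End.mul_apply, ih, co_D]; rfl
    rw [this, hM _ (by omega), map_zero]
  have usurj : Function.Surjective u := by
    have key : ∀ n v, (A ^ n) v = 0 → ∃ p, u p = v := by
      intro n
      induction n with
      | zero => intro v hv; exact ⟨0, by rw [map_zero]; simpa using hv.symm⟩
      | succ n ih =>
        intro v hv
        rw [pow_succ, Module.End.mul_apply] at hv
        obtain ⟨w, hw⟩ := ih _ hv
        have hDJ : derOp K (intOp K w) = w := LinearMap.congr_fun (DJ K) w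
        obtain ⟨c, hc⟩ := hker (v - l⁻¹ • u (intOp K w)) (by
          rw [map_sub, map_smul, uDv, hDJ, smul_smul, inv_mul_cancel₀ hl, one_smul, hw, sub_self])
        refine ⟨l⁻¹ • intOp K w + c • bB K 0, ?_⟩
        rw [map_add, map_smul, map_smul, hub]
        simp only [pow_zero, one_smul, Module.End.one_apply]
        rw [← hc]; abel
    intro v
    obtain ⟨k, hk⟩ := t.nilp v
    exact key k v hk
  -- u is eventually a shift
  obtain ⟨s, hs⟩ := ah N le_rfl
  obtain ⟨w, hw⟩ := usurj (bB K N)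
  have hHw : Hop K w = ((s : K) + 1) • w := by
    apply uinj
    rw [map_smul, ← Module.End.mul_apply, ← uH, Module.End.mul_apply, hw, hs]
  have hwm : w = co K s w • bB K s := by
    refine co_ext K fun m => ?_
    have h1 := congrArg (co K m) hHw
    rw [co_H, map_smul, smul_eq_mul] at h1
    rw [map_smul, co_b]
    by_cases hm : s = m
    · subst hm; simp
    · rw [if_neg hm, smul_zero]
      have h2 : ((m : K) - s) * co K m w = 0 := by linear_combination h1
      rcases mul_eq_zero.mp h2 with h3 | h3
      · exact absurd (Nat.cast_injective (sub_eq_zero.mp h3)).symm hm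
      · exact h3
  set c := co K s w with hc
  have hc0 : c ≠ 0 := by
    intro h0
    rw [h0, zero_smul] at hwm
    rw [hwm, map_zero] at hw
    exact (bB K).ne_zero N hw.symm
  have hshift : ∀ k : ℕ, u (bB K (s + k)) = c⁻¹ • bB K (N + k) := by
    intro k
    induction k with
    | zero =>
      rw [hwm, map_smul] at hw
      rw [add_zero, add_zero, ← hw, smul_smul, inv_mul_cancel₀ hc0, one_smul]
    | succ k ih =>
      rw [← add_assoc, ← J_apply, ← Module.End.mul_apply, uJ, LinearMap.smul_apply,
        Module.End.mul_apply, ih, map_smul, aB _ (by omega), smul_comm l, smul_smul l,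
        mul_inv_cancel₀ hl, one_smul, add_assoc]
  have hsN : s = N := by
    rcases le_total s N with h1 | h1
    · obtain ⟨k, hk⟩ := Nat.exists_eq_add_of_le h1
      have := index_surj (T := u) (inv_ne_zero hc0) (k := k) (N := s) (fun n hn => by
        obtain ⟨j, rfl⟩ := Nat.exists_eq_add_of_le hn
        rw [hshift, hk]; congr 2; ring) usurj
      omega
    · obtain ⟨k, hk⟩ := Nat.exists_eq_add_of_le h1
      have := index_inj (T := u) (inv_ne_zero hc0) (k := k) (N := N) (fun n hn => by
        obtain ⟨j, rfl⟩ := Nat.exists_eq_add_of_le hn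
        rw [← hshift, hk]; congr 2; ring) uinj
      omega
  subst hsN
  -- the inverse
  set E := LinearEquiv.ofBijective u ⟨uinj, usurj⟩ with hE
  set g : Module.End K (Polynomial K) := E.symm.toLinearMap with hg
  have ug : u * g = 1 := LinearMap.ext fun x => E.apply_symm_apply x
  have gu : g * u = 1 := LinearMap.ext fun x => E.symm_apply_apply x
  have conj : ∀ x : Module.End K (Polynomial K), (c • u) * x * (c⁻¹ • g) = u * x * g := by
    intro x
    rw [smul_mul_assoc, smul_mul_assoc, mul_smul_comm, smul_smul, mul_inv_cancel₀ hc0, one_smul]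
  have hcu : ∀ n, s ≤ n → (c • u) (bB K n) = bB K n := by
    intro n hn
    obtain ⟨j, rfl⟩ := Nat.exists_eq_add_of_le hn
    rw [LinearMap.smul_apply, hshift, smul_smul, mul_inv_cancel₀ hc0, one_smul]
  have gu1 : (c⁻¹ • g) * (c • u) = 1 := by
    rw [smul_mul_assoc, mul_smul_comm, smul_smul, inv_mul_cancel₀ hc0, one_smul, gu]
  refine ⟨l, c • u, c⁻¹ • g, hl, ⟨s, fun n hn => ?_⟩, ⟨s, fun n hn => ?_⟩, ?_, gu1, ?_, ?_, ?_⟩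
  · rw [LinearMap.sub_apply, hcu n hn]; exact sub_self _
  · have h1 := LinearMap.congr_fun gu1 (bB K n)
    rw [Module.End.mul_apply, hcu n hn] at h1
    rw [LinearMap.sub_apply, h1, sub_self]
  · have := conj 1
    rwa [mul_one, mul_one, ug] at this
  · rw [conj, ← uH, mul_assoc, ug, mul_one]
  · rw [conj, uJ, smul_mul_assoc, smul_smul, inv_mul_cancel₀ hl, one_smul, mul_assoc, ug, mul_one]
  · rw [conj, ← smul_mul_assoc, ← uD, mul_assoc, ug, mul_one]

lemma rel_HD : Hop K * derOp K = derOp K * Hop K - derOp K := by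
  refine (bB K).ext fun n => ?_
  rcases n with _ | n
  · simp [D_zero, H_apply]
  · simp only [Module.End.mul_apply, LinearMap.sub_apply, D_succ, H_apply, map_smul]
    push_cast; module

lemma rel_HJ : Hop K * intOp K = intOp K * Hop K + intOp K := by
  refine (bB K).ext fun n => ?_
  simp only [Module.End.mul_apply, LinearMap.add_apply, J_apply, H_apply, map_smul]
  push_cast; module

lemma rel_HP : Hop K * (1 - intOp K * derOp K) = 1 - intOp K * derOp K := by
  refine (bB K).ext fun n => ?_
  rcases n with _ | n
  · simp [D_zero, H_apply]
  · simp [D_succ, J_apply]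

lemma rel_PH : (1 - intOp K * derOp K) * Hop K = 1 - intOp K * derOp K := by
  refine (bB K).ext fun n => ?_
  rcases n with _ | n
  · simp [D_zero, H_apply]
  · simp [D_succ, J_apply, H_apply]

lemma sig_sub (σ : I1 K →ₐ[K] I1 K) (a b : I1 K) : σ (a - b) = σ a - σ b := by
  have e : (a - b) + b = a := Subtype.ext (sub_add_cancel a.1 b.1)
  have h2 : σ (a - b) + σ b = σ a := by rw [← map_add, e]
  exact Subtype.ext (eq_sub_of_add_eq (congrArg Subtype.val h2))

lemma trip_of (σ : I1 K →ₐ[K] I1 K) :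
    Trip (K := K) (σ (DelI K)) (σ (IntI K)) (σ (HelI K)) where
  mA := (σ (DelI K)).2
  mB := (σ (IntI K)).2
  mh := (σ (HelI K)).2
  AB := by
    have h1 : DelI K * IntI K = 1 := Subtype.ext (DJ K)
    have h2 := congrArg σ h1
    rw [map_mul, map_one] at h2
    exact congrArg Subtype.val h2
  hA := by
    have h1 : HelI K * DelI K = DelI K * HelI K - DelI K := Subtype.ext rel_HD
    have h2 := congrArg σ h1
    rw [sig_sub, map_mul, map_mul] at h2
    exact congrArg Subtype.val h2
  hB := by
    have h1 : HelI K * IntI K = IntI K * HelI K + IntI K := Subtype.ext rel_HJ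
    have h2 := congrArg σ h1
    rw [map_add, map_mul, map_mul] at h2
    exact congrArg Subtype.val h2
  hP := by
    have h1 : HelI K * (1 - IntI K * DelI K) = 1 - IntI K * DelI K := Subtype.ext rel_HP
    have h2 := congrArg σ h1
    rw [map_mul, sig_sub, map_one, map_mul] at h2
    exact congrArg Subtype.val h2
  Ph := by
    have h1 : (1 - IntI K * DelI K) * HelI K = 1 - IntI K * DelI K := Subtype.ext rel_PH
    have h2 := congrArg σ h1
    rw [map_mul, sig_sub, map_one, map_mul] at h2
    exact congrArg Subtype.val h2

variable (K)

/-- For every `K`-algebra endomorphism `σ` of `I₁` there exist a nonzero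
scalar `ν ∈ K` and a unit `u` of `I₁` with `u - 1 ∈ F` such that `σ(H) = u H u⁻¹`,
`σ(∫) = ν • u ∫ u⁻¹` and `σ(∂) = ν⁻¹ • u ∂ u⁻¹`. -/
theorem endomorphism_is_torus_action_times_inner (σ : I1 K →ₐ[K] I1 K) :
    ∃ ν : K, ν ≠ 0 ∧ ∃ u : (I1 K)ˣ,
      ((u : I1 K) : Module.End K (Polynomial K)) - 1 ∈ Fspan K ∧
      σ (HelI K) = ↑u * HelI K * ↑u⁻¹ ∧
      σ (IntI K) = ν • (↑u * IntI K * ↑u⁻¹) ∧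
      σ (DelI K) = ν⁻¹ • (↑u * DelI K * ↑u⁻¹) := by
  obtain ⟨l, u, u', hl, h1, h2, h3, h4, h5, h6, h7⟩ := (trip_of σ).final
  have m1 : u ∈ I1 K := by
    have := add_mem (Fspan_le (mem_Fspan h1)) (one_mem (I1 K))
    rwa [sub_add_cancel] at this
  have m2 : u' ∈ I1 K := by
    have := add_mem (Fspan_le (mem_Fspan h2)) (one_mem (I1 K))
    rwa [sub_add_cancel] at this
  refine ⟨l⁻¹, inv_ne_zero hl, ⟨⟨u, m1⟩, ⟨u', m2⟩, Subtype.ext h3, Subtype.ext h4⟩,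
    mem_Fspan h1, Subtype.ext h5, Subtype.ext h6, Subtype.ext ?_⟩
  rw [inv_inv]
  exact h7

end
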